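/- Let R be a Cohen–Macaulay commutative noetherian local ring of Krull dimension d, let M be a nonzero totally reflexive R-module and let N be a nonzero maximal Cohen–Macaulay R-module (depth_R(N) = d). Fix a finite free presentation F₁ → F₀ → M → 0 and let T be its transpose (the cokernel of the induced map Hom_R(F₀,R) → Hom_R(F₁,R)). If Ext^j_R(T,N) = 0 for all 1 ≤ j ≤ d, then M ⊗_R N is maximal Cohen–Macaulay, i.e. depth_R(M ⊗_R N) = d. -/

import Mathlib

open CategoryTheory

universe u

/-- The `i`-th Ext module `Ext_R^i(M, N)` of `R`-modules `M` and `N`. -/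
noncomputable def extModule (R : Type u) [CommRing R] (M N : Type u)
    [AddCommGroup M] [Module R M] [AddCommGroup N] [Module R N] (i : ℕ) : ModuleCat.{u} R :=
  ((Ext R (ModuleCat.{u} R) i).obj (Opposite.op (ModuleCat.of R M))).obj (ModuleCat.of R N)

/-- The `i`-th Tor module `Tor^R_i(M, N)` of `R`-modules `M` and `N`. -/
noncomputable def torModule (R : Type u) [CommRing R] (M N : Type u)
    [AddCommGroup M] [Module R M] [AddCommGroup N] [Module R N] (i : ℕ) : ModuleCat.{u} R :=
  ((Tor (ModuleCat.{u} R) i).obj (ModuleCat.of R M)).obj (ModuleCat.of R N)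

/-- The depth of a module `M` over a local ring `R`:
`inf { i | Ext^i_R(k, M) ≠ 0 }` where `k` is the residue field, an element of `ℕ∞`
(the zero module has depth `⊤`, since the infimum of the empty set in `ℕ∞` is `⊤`). -/
noncomputable def moduleDepth (R : Type u) [CommRing R] [IsLocalRing R] (M : Type u)
    [AddCommGroup M] [Module R M] : ℕ∞ :=
  sInf {i : ℕ∞ | ∃ n : ℕ, i = (n : ℕ∞) ∧
    Nontrivial (extModule R (IsLocalRing.ResidueField R) M n)}

/-- A module `M` is totally reflexive if the canonical evaluation map `M → M**` is bijective
and `Ext^i_R(M, R) = 0 = Ext^i_R(M*, R)` for all `i > 0`. -/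
def IsTotallyReflexive (R : Type u) [CommRing R] (M : Type u)
    [AddCommGroup M] [Module R M] : Prop :=
  Function.Bijective (Module.Dual.eval R M) ∧
    (∀ i : ℕ, 0 < i → Subsingleton (extModule R M R i)) ∧
    (∀ i : ℕ, 0 < i → Subsingleton (extModule R (Module.Dual R M) R i))

/-- A module `P` has finite projective dimension iff for some `n`, `Ext^i_R(P, -)` vanishes
for all `i > n`. -/
def HasFiniteProjectiveDimension (R : Type u) [CommRing R] (P : Type u)
    [AddCommGroup P] [Module R P] : Prop :=
  ∃ n : ℕ, ∀ (N : Type u) [AddCommGroup N] [Module R N] (i : ℕ), n < i →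
    Subsingleton (extModule R P N i)

/-- A module `Q` has finite injective dimension iff for some `n`, `Ext^i_R(-, Q)` vanishes
for all `i > n`. -/
def HasFiniteInjectiveDimension (R : Type u) [CommRing R] (Q : Type u)
    [AddCommGroup Q] [Module R Q] : Prop :=
  ∃ n : ℕ, ∀ (N : Type u) [AddCommGroup N] [Module R N] (i : ℕ), n < i →
    Subsingleton (extModule R N Q i)

section

open Abelian Limits

/-- Vanishing of `Ext` computed by derived functors, in terms of a projective resolution. -/
lemma CategoryTheory.ProjectiveResolution.isZero_ext_iff {R : Type u} [CommRing R]
    {X : ModuleCat.{u} R} (P : ProjectiveResolution X) (Y : ModuleCat.{u} R) (n p m : ℕ)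
    (hp : (ComplexShape.up ℕ).prev n = p) (hm : n + 1 = m) :
    IsZero (((_root_.Ext R (ModuleCat.{u} R) n).obj (Opposite.op X)).obj Y) ↔
      ∀ f : P.complex.X n ⟶ Y, P.complex.d m n ≫ f = 0 →
        ∃ g : P.complex.X p ⟶ Y, P.complex.d n p ≫ g = f := by
  rw [(P.isoExt n Y).isZero_iff, ← HomologicalComplex.exactAt_iff_isZero_homology,
    HomologicalComplex.exactAt_iff' _ p n m hp (by simp [hm]),
    ShortComplex.moduleCat_exact_iff]
  rfl

lemma subsingleton_extModule_iff {R : Type u} [CommRing R] (M N : Type u)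
    [AddCommGroup M] [Module R M] [AddCommGroup N] [Module R N] (n : ℕ) :
    Subsingleton (extModule R M N n) ↔
      Subsingleton (Ext (ModuleCat.of R M) (ModuleCat.of R N) n) := by
  rw [← ModuleCat.isZero_iff_subsingleton, extModule]
  let P := ProjectiveResolution.of (ModuleCat.of R M)
  cases n with
  | zero =>
    rw [P.isZero_ext_iff _ 0 0 1 (by simp) rfl, Ext.homEquiv₀.subsingleton_congr]
    constructor
    · refine fun h ↦ subsingleton_of_forall_eq 0 fun f ↦ ?_
      obtain ⟨g, hg⟩ := h (P.π.f 0 ≫ f) ((Category.assoc _ _ _).symm.trans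
        ((congrArg (· ≫ f) P.complex_d_comp_π_f_zero).trans zero_comp))
      rw [P.complex.shape _ _ (by simp), zero_comp] at hg
      exact zero_of_epi_comp (P.π.f 0) hg.symm
    · intro h f hf
      refine ⟨0, ?_⟩
      rw [comp_zero, ← P.exact₀.g_desc f hf]
      rw [show P.exact₀.desc f hf = 0 from h.elim _ _, comp_zero]
  | succ n =>
    rw [P.isZero_ext_iff _ (n + 1) n (n + 2) (by simp) rfl]
    constructor
    · refine fun h ↦ subsingleton_of_forall_eq 0 fun x ↦ ?_
      obtain ⟨f, hf, rfl⟩ := P.extMk_surjective x (n + 2) rfl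
      exact (P.extMk_eq_zero_iff f _ rfl hf n rfl).2 (h f hf)
    · intro h f hf
      exact (P.extMk_eq_zero_iff f _ rfl hf n rfl).1 (Subsingleton.elim _ _)

lemma moduleDepth_eq_coe_iff {R : Type u} [CommRing R] [IsLocalRing R] (M : Type u)
    [AddCommGroup M] [Module R M] (d : ℕ) :
    moduleDepth R M = d ↔
      (∀ i < d, Subsingleton (Ext (ModuleCat.of R (IsLocalRing.ResidueField R))
        (ModuleCat.of R M) i)) ∧
      ¬ Subsingleton (Ext (ModuleCat.of R (IsLocalRing.ResidueField R))
        (ModuleCat.of R M) d) := by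
  simp_rw [← subsingleton_extModule_iff, not_subsingleton_iff_nontrivial]
  constructor
  · intro h
    refine ⟨fun i hi ↦ ?_, ?_⟩
    · by_contra hn
      rw [not_subsingleton_iff_nontrivial] at hn
      have : moduleDepth R M ≤ i := sInf_le ⟨i, rfl, hn⟩
      rw [h] at this
      exact absurd (by exact_mod_cast this) hi.not_ge
    · have hne : {i : ℕ∞ | ∃ n : ℕ, i = (n : ℕ∞) ∧
          Nontrivial (extModule R (IsLocalRing.ResidueField R) M n)}.Nonempty := by
        by_contra hne
        rw [Set.not_nonempty_iff_eq_empty] at hne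
        rw [moduleDepth, hne, sInf_empty] at h
        exact ENat.top_ne_natCast d h
      obtain ⟨n, hn, hn'⟩ := csInf_mem hne
      rw [moduleDepth, hn] at h
      rwa [← ENat.natCast_inj.1 h]
  · rintro ⟨h, hd⟩
    refine le_antisymm (sInf_le ⟨d, rfl, hd⟩) (le_sInf ?_)
    rintro _ ⟨n, rfl, hn⟩
    by_contra! hlt
    exact not_subsingleton_iff_nontrivial.2 hn (h n (by exact_mod_cast hlt))

lemma CategoryTheory.Abelian.Ext.subsingleton_of_iso {C : Type*} [Category* C] [Abelian C]
    [HasExt C] {X Y Z : C} (e : Y ≅ Z) (n : ℕ) [Subsingleton (Ext X Y n)] :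
    Subsingleton (Ext X Z n) := by
  refine subsingleton_of_forall_eq 0 fun x ↦ ?_
  rw [← x.comp_mk₀_id, ← e.inv_hom_id, ← Ext.mk₀_comp_mk₀,
    ← Ext.comp_assoc_of_third_deg_zero,
    Subsingleton.elim (x.comp (Ext.mk₀ e.inv) (add_zero n)) 0, Ext.zero_comp]

lemma CategoryTheory.ShortComplex.ShortExact.subsingleton_ext_X₁ {C : Type*} [Category* C]
    [Abelian C] [HasExt C] {S : ShortComplex C} (hS : S.ShortExact) (X : C) (n : ℕ)
    (h₂ : Subsingleton (Ext X S.X₂ n))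
    (h₃ : ∀ m, m + 1 = n → Subsingleton (Ext X S.X₃ m)) : Subsingleton (Ext X S.X₁ n) := by
  cases n with
  | zero =>
    have := hS.mono_f
    exact (Ext.postcomp_mk₀_injective_of_mono X S.f).subsingleton
  | succ n =>
    refine subsingleton_of_forall_eq 0 fun x ↦ ?_
    have := h₃ n rfl
    obtain ⟨y, rfl⟩ := Ext.covariant_sequence_exact₁ X hS x (Subsingleton.elim _ _) rfl
    rw [Subsingleton.elim y 0, Ext.zero_comp]

lemma CategoryTheory.ShortComplex.ShortExact.subsingleton_ext_X₃ {C : Type*} [Category* C]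
    [Abelian C] [HasExt C] {S : ShortComplex C} (hS : S.ShortExact) (X : C) (n : ℕ)
    (h₂ : Subsingleton (Ext X S.X₂ n)) (h₁ : Subsingleton (Ext X S.X₁ (n + 1))) :
    Subsingleton (Ext X S.X₃ n) := by
  refine subsingleton_of_forall_eq 0 fun x ↦ ?_
  obtain ⟨y, rfl⟩ := Ext.covariant_sequence_exact₃ X hS x rfl (Subsingleton.elim _ _)
  rw [Subsingleton.elim y 0, Ext.zero_comp]

/-- `Ext` into `Hom(G, N)` vanishes if `Ext` into `N` does and `G` is finite free. -/
lemma subsingleton_ext_linearMap {R : Type u} [CommRing R] (X : ModuleCat.{u} R)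
    (G N : Type u) [AddCommGroup G] [Module R G] [Module.Free R G] [Module.Finite R G]
    [AddCommGroup N] [Module R N] (n : ℕ)
    (h : Subsingleton (Ext X (ModuleCat.of R N) n)) :
    Subsingleton (Ext X (ModuleCat.of R (G →ₗ[R] N)) n) := by
  refine subsingleton_of_forall_eq 0 fun x ↦ ?_
  let b := Module.Free.chooseBasis R G
  let p (j : Module.Free.ChooseBasisIndex R G) :
      ModuleCat.of R (G →ₗ[R] N) ⟶ ModuleCat.of R N := ModuleCat.ofHom (LinearMap.applyₗ (b j))
  let s (j : Module.Free.ChooseBasisIndex R G) :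
      ModuleCat.of R N ⟶ ModuleCat.of R (G →ₗ[R] N) :=
    ModuleCat.ofHom (LinearMap.smulRightₗ (b.coord j))
  have hid : ∑ j, p j ≫ s j = 𝟙 _ := by
    ext φ : 2
    refine b.ext fun i ↦ ?_
    simp [p, s, ModuleCat.hom_sum, Finsupp.single_apply]
  rw [← x.comp_mk₀_id, ← hid, Ext.mk₀_sum, Ext.comp_sum]
  refine Finset.sum_eq_zero fun j _ ↦ ?_
  rw [← Ext.mk₀_comp_mk₀, ← Ext.comp_assoc_of_third_deg_zero,
    Subsingleton.elim (x.comp (Ext.mk₀ (p j)) (add_zero n)) 0, Ext.zero_comp]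

/-- If `Ext^i(k, M) = 0` for all `i < n`, then `n ≤ dim M`. -/
lemma le_supportDim_of_subsingleton_ext {R : Type u} [CommRing R] [IsNoetherianRing R]
    [IsLocalRing R] (n : ℕ) (M : Type u) [AddCommGroup M] [Module R M] [Module.Finite R M]
    [Nontrivial M]
    (h : ∀ i < n, Subsingleton (Ext (ModuleCat.of R (IsLocalRing.ResidueField R))
        (ModuleCat.of R M) i)) :
    (n : WithBot ℕ∞) ≤ Module.supportDim R M := by
  induction n generalizing M with
  | zero =>
    have := Module.supportDim_ne_bot_of_nontrivial R M
    obtain ⟨a, ha⟩ := WithBot.ne_bot_iff_exists.1 this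
    rw [← ha]
    exact_mod_cast zero_le (a := a)
  | succ n ih =>
    have h0 : Subsingleton (IsLocalRing.ResidueField R →ₗ[R] M) := by
      have := h 0 n.succ_pos
      exact ((Ext.homEquiv₀ (X := ModuleCat.of R (IsLocalRing.ResidueField R))
        (Y := ModuleCat.of R M)).trans ModuleCat.homEquiv).symm.subsingleton
    obtain ⟨r, hr, reg⟩ := IsSMulRegular.subsingleton_linearMap_iff.1 h0
    have hr' : r ∈ IsLocalRing.maximalIdeal R := by
      have := Module.mem_annihilator.1 hr 1
      rwa [Algebra.smul_def, mul_one, IsLocalRing.ResidueField.algebraMap_eq,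
        IsLocalRing.residue_eq_zero_iff] at this
    have := nontrivial_quotSMulTop_of_mem_maximalIdeal M hr'
    rw [← Module.supportDim_quotSMulTop_succ_eq_supportDim reg hr']
    push_cast
    gcongr
    have hS := IsSMulRegular.smulShortComplex_shortExact (M := ModuleCat.of R M) reg
    exact ih (QuotSMulTop r M) fun i hi ↦
      hS.subsingleton_ext_X₃ _ i (h i (by lia)) (h (i + 1) (by lia))

/-- Let `G₁ → G₀ → T → 0` be a finite free presentation. If `Ext^j(T, N) = 0` for `1 ≤ j ≤ d`
and `Ext^i(X, N) = 0` for `i < d`, then `Ext^i(X, C) = 0` for `i < d`, where `C` is the cokernel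
of `Hom(G₀, N) → Hom(G₁, N)`. -/
lemma subsingleton_ext_quotient_range_lcomp {R : Type u} [CommRing R] [IsNoetherianRing R]
    (X : ModuleCat.{u} R) (N : Type u) [AddCommGroup N] [Module R N] (d : ℕ)
    (hN : ∀ i < d, Subsingleton (Ext X (ModuleCat.of R N) i))
    (G₁ G₀ T : Type u)
    [AddCommGroup G₁] [Module R G₁] [Module.Free R G₁] [Module.Finite R G₁]
    [AddCommGroup G₀] [Module R G₀] [Module.Free R G₀] [Module.Finite R G₀]
    [AddCommGroup T] [Module R T] (φ : G₁ →ₗ[R] G₀) (π : G₀ →ₗ[R] T)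
    (hφπ : Function.Exact φ π) (hπ : Function.Surjective π)
    (hT : ∀ j, 1 ≤ j → j ≤ d → Subsingleton (Ext (ModuleCat.of R T) (ModuleCat.of R N) j))
    (i : ℕ) (hi : i < d) :
    Subsingleton (Ext X (ModuleCat.of R ((G₁ →ₗ[R] N) ⧸ LinearMap.range (φ.lcomp R N))) i) := by
  induction d generalizing G₁ G₀ T i with
  | zero => lia
  | succ d ih =>
    obtain ⟨n, σ, hσ⟩ := Module.Finite.exists_fin' R (LinearMap.ker φ)
    let ψ : (Fin n → R) →ₗ[R] G₁ := (LinearMap.ker φ).subtype ∘ₗ σ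
    have hψ : LinearMap.range ψ = LinearMap.ker φ := by
      rw [LinearMap.range_comp, LinearMap.range_eq_top.2 hσ, Submodule.map_top,
        Submodule.range_subtype]
    let S := ShortComplex.moduleCatMk (LinearMap.range φ).subtype π (by
      ext ⟨_, y, rfl⟩; exact hφπ.apply_apply_eq_zero y)
    have hS : S.ShortExact := ModuleCat.shortComplex_shortExact _
      (LinearMap.exact_iff.2 (hφπ.linearMap_ker_eq.trans (Submodule.range_subtype _).symm))
      (Submodule.subtype_injective _) hπ
    have : Module.Free R S.X₂ := inferInstanceAs (Module.Free R G₀)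
    have extend (j : ℕ) (hj : j ≤ d) (x : Ext S.X₁ (ModuleCat.of R N) j) :
        ∃ y : Ext S.X₂ (ModuleCat.of R N) j, (Ext.mk₀ S.f).comp y (zero_add j) = x :=
      Ext.contravariant_sequence_exact₁ hS _ x rfl
        (@Subsingleton.elim _ (hT (1 + j) (by lia) (by lia)) _ _)
    have hK (j : ℕ) (hj : 1 ≤ j) (hjd : j ≤ d) :
        Subsingleton (Ext (ModuleCat.of R (LinearMap.range φ)) (ModuleCat.of R N) j) := by
      refine subsingleton_of_forall_eq 0 fun x ↦ ?_
      obtain ⟨y, rfl⟩ := extend j hjd x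
      obtain ⟨j, rfl⟩ := Nat.exists_eq_add_of_le' hj
      rw [Ext.eq_zero_of_projective y, Ext.comp_zero]
      rfl
    have hle : LinearMap.range (φ.lcomp R N) ≤ LinearMap.ker (ψ.lcomp R N) := by
      rintro _ ⟨α, rfl⟩
      ext x
      have : φ (ψ (Pi.single x 1)) = 0 := by
        rw [← LinearMap.mem_ker, ← hψ]
        exact LinearMap.mem_range_self _ _
      simp [this]
    let ι : ((G₁ →ₗ[R] N) ⧸ LinearMap.range (φ.lcomp R N)) →ₗ[R] ((Fin n → R) →ₗ[R] N) :=
      Submodule.liftQ _ (ψ.lcomp R N) hle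
    have hι : Function.Injective ι := by
      refine LinearMap.ker_eq_bot.1 (Submodule.ker_liftQ_eq_bot _ _ _ ?_)
      intro α hα
      have hle : LinearMap.ker φ ≤ LinearMap.ker α := by
        rw [← hψ]
        rintro _ ⟨x, rfl⟩
        exact LinearMap.congr_fun hα x
      let β : LinearMap.range φ →ₗ[R] N :=
        (LinearMap.ker φ).liftQ α hle ∘ₗ φ.quotKerEquivRange.symm
      obtain ⟨y, hy⟩ := extend 0 (by lia) (Ext.mk₀ (ModuleCat.ofHom β))
      obtain ⟨γ, rfl⟩ := (Ext.mk₀_bijective _ _).2 y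
      rw [Ext.mk₀_comp_mk₀] at hy
      replace hy := (Ext.mk₀_bijective _ _).1 hy
      refine ⟨γ.hom, ?_⟩
      ext x
      refine (LinearMap.congr_fun (congrArg ModuleCat.Hom.hom hy)
        ⟨φ x, LinearMap.mem_range_self φ x⟩).trans ?_
      change (LinearMap.ker φ).liftQ α hle
        (φ.quotKerEquivRange.symm ⟨φ x, LinearMap.mem_range_self φ x⟩) = α x
      rw [LinearMap.quotKerEquivRange_symm_apply_image, Submodule.mkQ_apply,
        Submodule.liftQ_apply]
    have hι' : LinearMap.range ι = LinearMap.range (ψ.lcomp R N) := Submodule.range_liftQ _ _ _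
    let S' := ShortComplex.moduleCatMk ι (LinearMap.range (ψ.lcomp R N)).mkQ
      (LinearMap.range_le_ker_iff.1 (by rw [hι', Submodule.ker_mkQ]))
    have hS' : S'.ShortExact := ModuleCat.shortComplex_shortExact _
      (LinearMap.exact_iff.2 ((Submodule.ker_mkQ _).trans hι'.symm)) hι
      (Submodule.mkQ_surjective _)
    refine hS'.subsingleton_ext_X₁ X i (subsingleton_ext_linearMap X (Fin n → R) N i (hN i hi)) ?_
    rintro i rfl
    exact ih (fun i hi ↦ hN i (by lia)) (Fin n → R) G₁ (LinearMap.range φ) ψ φ.rangeRestrict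
      (LinearMap.exact_iff.2 (by rw [LinearMap.ker_rangeRestrict, hψ]))
      φ.surjective_rangeRestrict hK i (by lia)

end

/-- The natural isomorphism `F ⊗ N ≃ Hom(F*, N)` for a finite projective module `F`. -/
noncomputable def tensorEquivDualHom (R F N : Type*) [CommRing R] [AddCommGroup F] [Module R F]
    [Module.Projective R F] [Module.Finite R F] [AddCommGroup N] [Module R N] :
    TensorProduct R F N ≃ₗ[R] (Module.Dual R F →ₗ[R] N) :=
  TensorProduct.congr (Module.evalEquiv R F) (LinearEquiv.refl R N) ≪≫ₗ
    dualTensorHomEquiv R (Module.Dual R F) N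

@[simp]
lemma tensorEquivDualHom_tmul (R : Type*) {F N : Type*} [CommRing R] [AddCommGroup F]
    [Module R F] [Module.Projective R F] [Module.Finite R F] [AddCommGroup N] [Module R N]
    (x : F) (n : N) (φ : Module.Dual R F) :
    tensorEquivDualHom R F N (TensorProduct.tmul R x n) φ = φ x • n := by
  simp [tensorEquivDualHom]

/-- The cokernel of `Hom(F₁*, N) → Hom(F₀*, N)` is `M ⊗ N`, for a finite projective
presentation `F₁ → F₀ → M → 0`. -/
noncomputable def dualQuotientEquivTensor {R : Type*} [CommRing R] {M F₀ F₁ : Type*} (N : Type*)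
    [AddCommGroup M] [Module R M] [AddCommGroup N] [Module R N]
    [AddCommGroup F₀] [Module R F₀] [Module.Projective R F₀] [Module.Finite R F₀]
    [AddCommGroup F₁] [Module R F₁] [Module.Projective R F₁] [Module.Finite R F₁]
    {f : F₁ →ₗ[R] F₀} {g : F₀ →ₗ[R] M} (hg : Function.Surjective g) (hfg : Function.Exact f g) :
    ((Module.Dual R F₀ →ₗ[R] N) ⧸ LinearMap.range (f.dualMap.lcomp R N)) ≃ₗ[R]
      TensorProduct R M N :=
  have comm (x : TensorProduct R F₁ N) :
      tensorEquivDualHom R F₀ N (f.rTensor N x) =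
        f.dualMap.lcomp R N (tensorEquivDualHom R F₁ N x) := by
    have : (tensorEquivDualHom R F₀ N).toLinearMap ∘ₗ f.rTensor N =
        f.dualMap.lcomp R N ∘ₗ (tensorEquivDualHom R F₁ N).toLinearMap := by
      ext x n φ
      simp
    exact LinearMap.congr_fun this x
  have ker_eq : LinearMap.range (f.dualMap.lcomp R N) =
      LinearMap.ker (g.rTensor N ∘ₗ (tensorEquivDualHom R F₀ N).symm.toLinearMap) := by
    ext α
    obtain ⟨y, rfl⟩ := (tensorEquivDualHom R F₀ N).surjective α
    rw [LinearMap.mem_ker, LinearMap.comp_apply, LinearEquiv.coe_coe,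
      LinearEquiv.symm_apply_apply, rTensor_exact N hfg hg y]
    constructor
    · rintro ⟨β, hβ⟩
      obtain ⟨x, rfl⟩ := (tensorEquivDualHom R F₁ N).surjective β
      exact ⟨x, (tensorEquivDualHom R F₀ N).injective ((comm x).trans hβ)⟩
    · rintro ⟨x, rfl⟩
      exact ⟨tensorEquivDualHom R F₁ N x, (comm x).symm⟩
  (Submodule.quotEquivOfEq _ _ ker_eq).trans
    (LinearMap.quotKerEquivOfSurjective _
      ((LinearMap.rTensor_surjective N hg).comp (tensorEquivDualHom R F₀ N).symm.surjective))

lemma exists_linearMap_residueField_ne_zero (R M : Type*) [CommRing R] [IsLocalRing R]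
    [AddCommGroup M] [Module R M] [Module.Finite R M] [Nontrivial M] :
    ∃ (u : M →ₗ[R] IsLocalRing.ResidueField R) (x : M), u x ≠ 0 := by
  by_contra! h
  refine not_subsingleton M ((IsLocalRing.subsingleton_tensorProduct
    (R := R) (M := M)).1 (subsingleton_of_forall_eq 0 fun z ↦ ?_))
  refine (Module.forall_dual_apply_eq_zero_iff (IsLocalRing.ResidueField R) z).1 fun ψ ↦ ?_
  have key (x : M) : ψ (TensorProduct.tmul R 1 x) = 0 :=
    h (ψ.restrictScalars R ∘ₗ TensorProduct.mk R _ M 1) x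
  have : ψ = 0 := by
    ext x
    simp [key]
  rw [this, LinearMap.zero_apply]

lemma IsLocalRing.nontrivial_tensorProduct_of_finite (R M N : Type*) [CommRing R]
    [IsLocalRing R] [AddCommGroup M] [Module R M] [Module.Finite R M] [Nontrivial M]
    [AddCommGroup N] [Module R N] [Module.Finite R N] [Nontrivial N] :
    Nontrivial (TensorProduct R M N) := by
  obtain ⟨u, x, hx⟩ := exists_linearMap_residueField_ne_zero R M
  obtain ⟨v, y, hy⟩ := exists_linearMap_residueField_ne_zero R N
  refine nontrivial_of_ne (TensorProduct.tmul R x y) 0 fun h ↦ mul_ne_zero hx hy ?_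
  simpa using congrArg (LinearMap.mul' R _ ∘ₗ TensorProduct.map u v) h

/-- Let `R` be a Cohen-Macaulay noetherian local ring of Krull dimension `d`, `M` a nonzero
totally reflexive `R`-module and `N` a nonzero maximal Cohen-Macaulay `R`-module, with `T` the
transpose of a finite free presentation of `M`.  If `Ext^j_R(T, N) = 0` for `1 ≤ j ≤ d`, then
`M ⊗ N` is maximal Cohen-Macaulay, i.e. `depth(M ⊗ N) = d`. -/
theorem tensor_mcm_of_totallyReflexive_of_mcm
    (R : Type u) [CommRing R] [IsNoetherianRing R] [IsLocalRing R]
    (d : ℕ) (hdim : ringKrullDim R = d) (hCM : moduleDepth R R = (d : ℕ∞))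
    (M N : Type u) [AddCommGroup M] [Module R M] [Module.Finite R M] [Nontrivial M]
    [AddCommGroup N] [Module R N] [Module.Finite R N] [Nontrivial N]
    (hM : IsTotallyReflexive R M)
    (hN : moduleDepth R N = (d : ℕ∞))
    (F₀ F₁ : Type u)
    [AddCommGroup F₀] [Module R F₀] [Module.Free R F₀] [Module.Finite R F₀]
    [AddCommGroup F₁] [Module R F₁] [Module.Free R F₁] [Module.Finite R F₁]
    (f : F₁ →ₗ[R] F₀) (g : F₀ →ₗ[R] M)
    (hg : Function.Surjective g) (hfg : LinearMap.range f = LinearMap.ker g)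
    (hExt : ∀ j : ℕ, 1 ≤ j → j ≤ d →
      Subsingleton (extModule R
        (Module.Dual R F₁ ⧸ LinearMap.range (LinearMap.dualMap f)) N j)) :
    moduleDepth R (TensorProduct R M N) = (d : ℕ∞) := by
  have hvan : ∀ i < d, Subsingleton (Abelian.Ext
      (ModuleCat.of R (IsLocalRing.ResidueField R)) (ModuleCat.of R (TensorProduct R M N)) i) := by
    intro i hi
    have := subsingleton_ext_quotient_range_lcomp
      (ModuleCat.of R (IsLocalRing.ResidueField R)) N d ((moduleDepth_eq_coe_iff N d).1 hN).1
      (Module.Dual R F₀) (Module.Dual R F₁)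
      (Module.Dual R F₁ ⧸ LinearMap.range (LinearMap.dualMap f)) f.dualMap
      (LinearMap.range f.dualMap).mkQ (LinearMap.exact_map_mkQ_range _)
      (Submodule.mkQ_surjective _)
      (fun j hj hjd ↦ (subsingleton_extModule_iff _ _ _).1 (hExt j hj hjd)) i hi
    exact Abelian.Ext.subsingleton_of_iso
      (dualQuotientEquivTensor N hg (LinearMap.exact_iff.2 hfg.symm)).toModuleIso i
  refine (moduleDepth_eq_coe_iff _ d).2 ⟨hvan, fun hd ↦ ?_⟩
  have := IsLocalRing.nontrivial_tensorProduct_of_finite R M N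
  have hle := (le_supportDim_of_subsingleton_ext (d + 1) (TensorProduct R M N) fun i hi ↦ by
    obtain hi | rfl := Nat.lt_succ_iff_lt_or_eq.1 hi
    exacts [hvan i hi, hd]).trans (Module.supportDim_le_ringKrullDim R _)
  rw [hdim] at hle
  exact absurd (by exact_mod_cast hle) (Nat.not_succ_le_self d)
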